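/- arXiv:2012.12950 — 6 statements merged into one kernel-verified Lean document; each statement's English description precedes it below -/
import Mathlib

section
/- Eigenvector formula for a rank-one Hermitian perturbation (equation (1.8)): let n ≥ 1, let S be an n×n complex Hermitian matrix, let v ∈ ℂⁿ be a unit vector, let θ > 0 be real, and set B = θ·v v* + S. Suppose λ is real, λ·I − S is positive definite, and v* (λ·I − S)⁻¹ v = 1/θ. Then the vector w := (λ·I − S)⁻¹ v is nonzero and satisfies B·w = λ·w; i.e., w is an eigenvector of B for the eigenvalue λ. -/
open Matrix
open scoped ComplexOrder

/-- Equation (1.8): for `B = θ·v v* + S` with `S` Hermitian, `v` a unit vector, `θ > 0`,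
if `λ·I − S` is positive definite and `v* (λ·I − S)⁻¹ v = 1/θ`, then
`w = (λ·I − S)⁻¹ v` is an eigenvector of `B` for the eigenvalue `λ`. -/
theorem rank_one_perturbation_eigenvector
    {n : ℕ} (hn : 1 ≤ n) (S : Matrix (Fin n) (Fin n) ℂ) (hS : S.IsHermitian)
    (v : Fin n → ℂ) (hv : star v ⬝ᵥ v = 1) (θ : ℝ) (hθ : 0 < θ)
    (B : Matrix (Fin n) (Fin n) ℂ)
    (hB : B = (θ : ℂ) • vecMulVec v (star v) + S)
    (l : ℝ) (hpos : ((l : ℂ) • (1 : Matrix (Fin n) (Fin n) ℂ) - S).PosDef)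
    (heq : star v ⬝ᵥ (((l : ℂ) • (1 : Matrix (Fin n) (Fin n) ℂ) - S)⁻¹ *ᵥ v) = (θ : ℂ)⁻¹)
    (w : Fin n → ℂ)
    (hw : w = ((l : ℂ) • (1 : Matrix (Fin n) (Fin n) ℂ) - S)⁻¹ *ᵥ v) :
    w ≠ 0 ∧ B *ᵥ w = (l : ℂ) • w := by
  have hθ' : (θ : ℂ) ≠ 0 := by exact_mod_cast hθ.ne'
  rw [← hw] at heq
  refine ⟨?_, ?_⟩
  · rintro rfl
    rw [dotProduct_zero] at heq
    exact inv_ne_zero hθ' heq.symm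
  · have hdet := (Matrix.isUnit_iff_isUnit_det _).mp hpos.isUnit
    have hMw : ((l : ℂ) • (1 : Matrix (Fin n) (Fin n) ℂ) - S) *ᵥ w = v := by
      rw [hw, mulVec_mulVec, mul_nonsing_inv _ hdet, one_mulVec]
    have hrank : ((θ : ℂ) • vecMulVec v (star v)) *ᵥ w = v := by
      rw [smul_mulVec, vecMulVec_mulVec, heq]
      ext i
      simp only [Pi.smul_apply, smul_eq_mul, MulOpposite.smul_eq_mul_unop, MulOpposite.unop_op]
      field_simp
    rw [sub_mulVec, smul_mulVec, one_mulVec] at hMw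
    rw [hB, add_mulVec, hrank, ← hMw, sub_add_cancel]
end

section
/- Lemma 3.1 (weak convergence along independent random indices): let S be a metric space with its Borel σ-algebra, let (Ω, 𝔽, ℙ) be a probability space, let X_n, X : Ω → S be measurable (n ∈ ℕ), and suppose X_n converges to X in distribution, i.e. for every bounded continuous f : S → ℝ, E[f(X_n)] → E[f(X)]. For each n let ℓ_n : Ω → ℕ be a measurable positive-integer-valued random variable that is independent of the σ-algebra generated by the entire sequence (X_k)_{k∈ℕ}, and suppose that for every j ∈ ℕ, ℙ(ℓ_n ≤ j) → 0 as n → ∞. Then X_{ℓ_n} converges to X in distribution: for every bounded continuous f : S → ℝ, E[f(ω ↦ X_{ℓ_n(ω)}(ω))] → E[f(X)]. -/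
open MeasureTheory Filter ProbabilityTheory

/-- Averaging a family of integrable variables along an independent random index amounts to
averaging their expectations. -/
theorem integral_random_index_eq {S Ω : Type*} [MeasurableSpace S] [MeasurableSpace Ω]
    {P : Measure Ω} [IsProbabilityMeasure P] {X : ℕ → Ω → S} (hX : ∀ k, Measurable (X k))
    {N : Ω → ℕ} (hN : Measurable N) (hindep : ∀ k, IndepFun N (X k) P)
    {g : S → ℝ} (hg : Measurable g) {M : ℝ} (hM : ∀ x, |g x| ≤ M) :
    ∫ ω, g (X (N ω) ω) ∂P = ∫ ω, (∫ ω', g (X (N ω) ω') ∂P) ∂P := by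
  have hmeas : ∀ k, MeasurableSet (N ⁻¹' {k}) := fun k => hN (measurableSet_singleton k)
  have hdisj : Pairwise (Function.onFun Disjoint fun k => N ⁻¹' {k}) :=
    pairwise_disjoint_fiber N
  have hunion : ⋃ k, N ⁻¹' {k} = Set.univ := by ext; simp
  have hmean : ∀ k, |∫ ω', g (X k ω') ∂P| ≤ M := fun k => by
    simpa using norm_integral_le_of_norm_le_const (μ := P) (f := fun ω' => g (X k ω'))
      (.of_forall fun ω' => hM (X k ω'))
  have hmeasX : Measurable fun ω => g (X (N ω) ω) :=
    (measurable_from_prod_countable_right (f := fun p : ℕ × Ω => g (X p.1 p.2))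
      fun k => hg.comp (hX k)).comp (hN.prodMk measurable_id)
  have hintX : Integrable (fun ω => g (X (N ω) ω)) P :=
    .of_bound hmeasX.aestronglyMeasurable M (.of_forall fun ω => hM _)
  have hintE : Integrable (fun ω => ∫ ω', g (X (N ω) ω') ∂P) P :=
    .of_bound ((measurable_of_countable fun k => ∫ ω', g (X k ω') ∂P).comp
      hN).aestronglyMeasurable M (.of_forall fun ω => hmean _)
  have hfiber : ∀ k, ∫ ω in N ⁻¹' {k}, g (X (N ω) ω) ∂P =
      ∫ ω in N ⁻¹' {k}, (∫ ω', g (X (N ω) ω') ∂P) ∂P := by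
    intro k
    have hprod := (hindep k).integral_fun_comp_mul_comp hN.aemeasurable (hX k).aemeasurable
      (f := ({k} : Set ℕ).indicator (1 : ℕ → ℝ)) (g := g)
      (measurable_of_countable _).aestronglyMeasurable hg.aestronglyMeasurable
    calc
      _ = ∫ ω in N ⁻¹' {k}, g (X k ω) ∂P :=
        setIntegral_congr_fun (hmeas k) fun ω hω => by
          have h : N ω = k := hω
          simp only [h]
      _ = ∫ ω, ({k} : Set ℕ).indicator (1 : ℕ → ℝ) (N ω) * g (X k ω) ∂P := by
        rw [← integral_indicator (hmeas k)]
        refine integral_congr_ae (.of_forall fun ω => ?_)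
        by_cases h : N ω = k <;> simp [h]
      _ = ∫ ω, ({k} : Set ℕ).indicator (1 : ℕ → ℝ) (N ω) * (∫ ω', g (X k ω') ∂P) ∂P := by
        rw [hprod, integral_mul_const]
      _ = ∫ ω in N ⁻¹' {k}, (∫ ω', g (X (N ω) ω') ∂P) ∂P := by
        rw [← integral_indicator (hmeas k)]
        refine integral_congr_ae (.of_forall fun ω => ?_)
        by_cases h : N ω = k <;> simp [h]
  rw [← setIntegral_univ (f := fun ω => g (X (N ω) ω)),
    ← setIntegral_univ (f := fun ω => ∫ ω', g (X (N ω) ω') ∂P), ← hunion,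
    integral_iUnion hmeas hdisj hintX.integrableOn,
    integral_iUnion hmeas hdisj hintE.integrableOn]
  exact tsum_congr hfiber

/-- If a bounded real sequence `a` converges and the random indices `N n` tend to infinity in
probability, then the expectation of `a (N n)` converges to the same limit. -/
theorem tendsto_integral_comp_of_tendsto_atTop {Ω : Type*} [MeasurableSpace Ω]
    {P : Measure Ω} [IsProbabilityMeasure P] {a : ℕ → ℝ} {c : ℝ} (ha : Tendsto a atTop (nhds c))
    {N : ℕ → Ω → ℕ} (hN : ∀ n, Measurable (N n))
    (htail : ∀ j : ℕ, Tendsto (fun n => P {ω | N n ω ≤ j}) atTop (nhds 0)) :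
    Tendsto (fun n => ∫ ω, a (N n ω) ∂P) atTop (nhds c) := by
  obtain ⟨M, hM⟩ := (Metric.isBounded_range_of_tendsto a ha).exists_norm_le
  have hM' : ∀ k, |a k| ≤ M := fun k => hM _ ⟨k, rfl⟩
  have hint : ∀ n, Integrable (fun ω => a (N n ω)) P := fun n =>
    .of_bound ((measurable_of_countable a).comp (hN n)).aestronglyMeasurable M
      (.of_forall fun ω => hM' _)
  rw [Metric.tendsto_atTop]
  intro ε hε
  obtain ⟨j, hj⟩ := Metric.tendsto_atTop.1 ha (ε / 2) (half_pos hε)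
  have hreal : Tendsto (fun n => ε / 2 + (M + |c|) * P.real {ω | N n ω ≤ j}) atTop
      (nhds (ε / 2)) := by
    have h := (ENNReal.tendsto_toReal ENNReal.zero_ne_top).comp (htail j)
    simpa [Measure.real, Function.comp_def] using (h.const_mul (M + |c|)).const_add (ε / 2)
  obtain ⟨n₀, hn₀⟩ := eventually_atTop.1 (hreal.eventually_lt_const (half_lt_self hε))
  refine ⟨n₀, fun n hn => lt_of_le_of_lt ?_ (hn₀ n hn)⟩
  have hmeas : MeasurableSet {ω | N n ω ≤ j} := hN n measurableSet_Iic
  have hind : Integrable ({ω | N n ω ≤ j}.indicator fun _ => M + |c|) P :=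
    (integrable_const _).indicator hmeas
  have hsub : (∫ ω, a (N n ω) ∂P) - c = ∫ ω, (a (N n ω) - c) ∂P := by
    rw [integral_sub (hint n) (integrable_const c)]
    simp
  rw [Real.dist_eq, hsub]
  calc
    |∫ ω, (a (N n ω) - c) ∂P| ≤
        ∫ ω, (ε / 2 + {ω | N n ω ≤ j}.indicator (fun _ => M + |c|) ω) ∂P := by
      rw [← Real.norm_eq_abs]
      refine norm_integral_le_of_norm_le ((integrable_const _).add hind) (.of_forall fun ω => ?_)
      rw [Real.norm_eq_abs]
      by_cases h : N n ω ≤ j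
      · rw [Set.indicator_of_mem (show ω ∈ {ω | N n ω ≤ j} from h)]
        linarith [abs_sub (a (N n ω)) c, hM' (N n ω)]
      · rw [Set.indicator_of_notMem (show ω ∉ {ω | N n ω ≤ j} from h), add_zero]
        exact (hj _ (not_le.1 h).le).le
    _ = ε / 2 + (M + |c|) * P.real {ω | N n ω ≤ j} := by
      rw [integral_add (integrable_const _) hind, integral_indicator_const _ hmeas]
      simp [mul_comm]

/-- Lemma 3.1: if `X n → X` in distribution and `ℓ n` are positive-integer-valued random
indices, independent of the whole sequence `(X k)`, with `ℙ(ℓ n ≤ j) → 0` for every `j`,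
then `X (ℓ n) → X` in distribution. -/
theorem tendsto_in_distribution_random_index
    {S : Type*} [MetricSpace S] [MeasurableSpace S] [BorelSpace S]
    {Ω : Type*} [MeasurableSpace Ω] (P : Measure Ω) [IsProbabilityMeasure P]
    (X : ℕ → Ω → S) (X' : Ω → S)
    (hX : ∀ n, Measurable (X n)) (hX' : Measurable X')
    (hconv : ∀ f : BoundedContinuousFunction S ℝ,
      Tendsto (fun n => ∫ ω, f (X n ω) ∂P) atTop (nhds (∫ ω, f (X' ω) ∂P)))
    (L : ℕ → Ω → ℕ) (hLmeas : ∀ n, Measurable (L n)) (hLpos : ∀ n ω, 1 ≤ L n ω)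
    (hLindep : ∀ n, Indep (MeasurableSpace.comap (L n) ⊤)
      (⨆ k : ℕ, MeasurableSpace.comap (X k) inferInstance) P)
    (hLtail : ∀ j : ℕ, Tendsto (fun n => P {ω | L n ω ≤ j}) atTop (nhds 0)) :
    ∀ f : BoundedContinuousFunction S ℝ,
      Tendsto (fun n => ∫ ω, f (X (L n ω) ω) ∂P) atTop (nhds (∫ ω, f (X' ω) ∂P)) := by
  intro f
  have hindep : ∀ n k, IndepFun (L n) (X k) P := fun n k =>
    (IndepFun_iff_Indep _ _ _).2 (indep_of_indep_of_le_right (hLindep n)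
      (le_iSup (fun k => MeasurableSpace.comap (X k) inferInstance) k))
  simp_rw [fun n => integral_random_index_eq hX (hLmeas n) (hindep n) f.continuous.measurable
    f.norm_coe_le_norm]
  exact tendsto_integral_comp_of_tendsto_atTop (hconv f) hLmeas hLtail
end

section
/- Projection moment inequality: let n ≥ 3 and let P be a random n×n real matrix on a probability space (Ω, 𝔽, ℙ) such that ℙ-almost surely P(ω) is symmetric and idempotent (an orthogonal projection), and such that the law of P is invariant under conjugation by every permutation matrix: for every n×n permutation matrix Π, the random matrix Π P Πᵀ has the same law as P. Then (n − 2) · E[ P₁₂² P₁₃² ] ≤ E[ P₁₂² P₁₁ ], where P_ij denotes the (i,j) entry of P and the indices 1, 2, 3 are any three distinct coordinates. -/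
open Matrix MeasureTheory

/-- The Borel σ-algebra on matrices (with the entrywise topology). -/
noncomputable instance matrixMeasurableSpace {l m R : Type*} [TopologicalSpace R] :
    MeasurableSpace (Matrix l m R) := borel _

theorem Matrix.permMatrix_conj_apply {ι R : Type*} [Fintype ι] [DecidableEq ι] [Semiring R]
    (σ : Equiv.Perm ι) (A : Matrix ι ι R) (a b : ι) :
    (σ.permMatrix R * A * (σ.permMatrix R)ᵀ) a b = A (σ a) (σ b) := by
  simp [Equiv.Perm.permMatrix, PEquiv.toMatrix_toPEquiv_mul, ← PEquiv.toMatrix_symm,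
    ← Equiv.toPEquiv_symm, PEquiv.mul_toMatrix_toPEquiv]

/-- The rows of a symmetric idempotent matrix have squared norm equal to the diagonal entry. -/
theorem Matrix.IsSymm.sum_sq_row_of_mul_self {ι R : Type*} [Fintype ι] [CommSemiring R]
    {A : Matrix ι ι R} (hA : A.IsSymm) (hAA : A * A = A) (a : ι) :
    ∑ b, A a b ^ 2 = A a a := by
  conv_rhs => rw [← hAA, Matrix.mul_apply]
  exact Finset.sum_congr rfl fun b _ => by rw [hA.apply a b, sq]

theorem Matrix.IsSymm.diag_le_one_of_mul_self {ι : Type*} [Fintype ι]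
    {A : Matrix ι ι ℝ} (hA : A.IsSymm) (hAA : A * A = A) (a : ι) : A a a ≤ 1 := by
  have h : A a a ^ 2 ≤ ∑ b, A a b ^ 2 :=
    Finset.single_le_sum (f := fun b => A a b ^ 2) (fun b _ => sq_nonneg _) (Finset.mem_univ a)
  rw [hA.sum_sq_row_of_mul_self hAA] at h
  nlinarith

theorem Matrix.IsSymm.sq_apply_le_one_of_mul_self {ι : Type*} [Fintype ι]
    {A : Matrix ι ι ℝ} (hA : A.IsSymm) (hAA : A * A = A) (a b : ι) : A a b ^ 2 ≤ 1 := by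
  have h : A a b ^ 2 ≤ ∑ c, A a c ^ 2 :=
    Finset.single_le_sum (f := fun c => A a c ^ 2) (fun c _ => sq_nonneg _) (Finset.mem_univ b)
  rw [hA.sum_sq_row_of_mul_self hAA] at h
  exact h.trans (hA.diag_le_one_of_mul_self hAA a)

/-- Projection moment inequality: for a random orthogonal projection `P` (of size `n ≥ 3`)
whose law is invariant under conjugation by permutation matrices, and any three distinct
coordinates `i, j, k`, one has `(n − 2)·E[P_{ij}² P_{ik}²] ≤ E[P_{ij}² P_{ii}]`. -/
theorem projection_moment_inequality
    (n : ℕ) (hn : 3 ≤ n)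
    {Ω : Type*} [MeasurableSpace Ω] (P : Measure Ω) [IsProbabilityMeasure P]
    (M : Ω → Matrix (Fin n) (Fin n) ℝ) (hMmeas : Measurable M)
    (hproj : ∀ᵐ ω ∂P, (M ω).IsSymm ∧ M ω * M ω = M ω)
    (hinv : ∀ σ : Equiv.Perm (Fin n),
      Measure.map (fun ω => σ.permMatrix ℝ * M ω * (σ.permMatrix ℝ)ᵀ) P
        = Measure.map M P)
    (i j k : Fin n) (hij : i ≠ j) (hik : i ≠ k) (hjk : j ≠ k) :
    ((n : ℝ) - 2) * ∫ ω, (M ω i j) ^ 2 * (M ω i k) ^ 2 ∂P ≤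
      ∫ ω, (M ω i j) ^ 2 * M ω i i ∂P := by
  have : BorelSpace (Matrix (Fin n) (Fin n) ℝ) := ⟨rfl⟩
  have hentry (a b : Fin n) : Measurable fun ω => M ω a b :=
    (continuous_id.matrix_elem a b).measurable.comp hMmeas
  have hint (l : Fin n) : Integrable (fun ω => M ω i j ^ 2 * M ω i l ^ 2) P := by
    refine Integrable.of_bound (C := 1)
      (((hentry i j).pow_const 2).mul ((hentry i l).pow_const 2)).aestronglyMeasurable ?_
    filter_upwards [hproj] with ω ⟨hs, hp⟩
    rw [Real.norm_of_nonneg (by positivity)]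
    exact mul_le_one₀ (hs.sq_apply_le_one_of_mul_self hp i j) (sq_nonneg _)
      (hs.sq_apply_le_one_of_mul_self hp i l)
  have hint' : Integrable (fun ω => M ω i j ^ 2 * M ω i i) P := by
    refine Integrable.of_bound (C := 1)
      (((hentry i j).pow_const 2).mul (hentry i i)).aestronglyMeasurable ?_
    filter_upwards [hproj] with ω ⟨hs, hp⟩
    have h0 : 0 ≤ M ω i i := by
      rw [← hs.sum_sq_row_of_mul_self hp]
      positivity
    rw [Real.norm_of_nonneg (by positivity)]
    exact mul_le_one₀ (hs.sq_apply_le_one_of_mul_self hp i j) h0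
      (hs.diag_le_one_of_mul_self hp i)
  have hswap (l : Fin n) (hl : l ∈ (Finset.univ.erase i).erase j) :
      ∫ ω, M ω i j ^ 2 * M ω i l ^ 2 ∂P = ∫ ω, M ω i j ^ 2 * M ω i k ^ 2 ∂P := by
    obtain ⟨hlj, hli⟩ : l ≠ j ∧ l ≠ i := by simpa using hl
    let f : Matrix (Fin n) (Fin n) ℝ → ℝ := fun A => A i j ^ 2 * A i k ^ 2
    have hf : Continuous f := by fun_prop
    have hconj : Measurable fun ω =>
        (Equiv.swap k l).permMatrix ℝ * M ω * ((Equiv.swap k l).permMatrix ℝ)ᵀ :=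
      (show Continuous fun A : Matrix (Fin n) (Fin n) ℝ =>
        (Equiv.swap k l).permMatrix ℝ * A * ((Equiv.swap k l).permMatrix ℝ)ᵀ by
          fun_prop).measurable.comp hMmeas
    have h : ∫ A, f A ∂(P.map fun ω =>
        (Equiv.swap k l).permMatrix ℝ * M ω * ((Equiv.swap k l).permMatrix ℝ)ᵀ) =
        ∫ A, f A ∂(P.map M) := by
      rw [hinv]
    rw [integral_map hconj.aemeasurable hf.measurable.aestronglyMeasurable,
      integral_map hMmeas.aemeasurable hf.measurable.aestronglyMeasurable] at h
    simpa only [f, Matrix.permMatrix_conj_apply, Equiv.swap_apply_left,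
      Equiv.swap_apply_of_ne_of_ne hik hli.symm,
      Equiv.swap_apply_of_ne_of_ne hjk hlj.symm] using h
  have hcard : ((((Finset.univ : Finset (Fin n)).erase i).erase j).card : ℝ) = n - 2 := by
    rw [Finset.card_erase_of_mem (by simp [hij.symm]), Finset.card_erase_of_mem (by simp),
      Finset.card_univ, Fintype.card_fin, Nat.sub_sub, Nat.cast_sub (by lia)]
    norm_num
  rw [← hcard, ← nsmul_eq_mul, ← Finset.sum_const, ← Finset.sum_congr rfl hswap,
    ← integral_finsetSum _ fun l _ => hint l]
  refine integral_mono_ae (integrable_finsetSum _ fun l _ => hint l) hint' ?_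
  filter_upwards [hproj] with ω ⟨hs, hp⟩
  rw [← Finset.mul_sum, ← hs.sum_sq_row_of_mul_self hp i]
  exact mul_le_mul_of_nonneg_left
    (Finset.sum_le_sum_of_subset_of_nonneg (Finset.subset_univ _) fun _ _ _ => sq_nonneg _)
    (sq_nonneg _)
end

section
/- Moment-integral determinacy of laws of continuous vector-valued processes (uniqueness part of Theorem 3.2): let d ≥ 1 and let X : Ω → (Fin d → C([0,1], ℝ)) and Y : Ω′ → (Fin d → C([0,1], ℝ)) be Borel-measurable random elements on probability spaces (Ω, ℙ) and (Ω′, ℙ′), where C([0,1], ℝ) carries the supremum-norm topology. Define Φ : (Fin d → C([0,1], ℝ)) → (ℕ → Fin d → ℝ) by Φ(g)(r)(i) = ∫₀¹ tʳ · g(i)(t) dt, and equip ℕ → Fin d → ℝ with the product σ-algebra of the Borel σ-algebras on ℝ. If the pushforward laws of Φ ∘ X under ℙ and of Φ ∘ Y under ℙ′ coincide, then the laws of X and Y coincide: (X)_*ℙ = (Y)_*ℙ′ as Borel measures on Fin d → C([0,1], ℝ). -/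
open MeasureTheory

lemma ContinuousMap.continuous_integral_of_isFiniteMeasure {α : Type*} [TopologicalSpace α]
    [CompactSpace α] [MeasurableSpace α] [BorelSpace α] [SecondCountableTopologyEither α ℝ]
    (μ : Measure α) [IsFiniteMeasure μ] :
    Continuous fun f : C(α, ℝ) => ∫ t, f t ∂μ := by
  have h := (MeasureTheory.continuous_integral (μ := μ) (G := ℝ)).comp
    (ContinuousMap.toLp (E := ℝ) 1 μ ℝ).continuous
  refine h.congr fun f => ?_
  exact integral_congr_ae (ContinuousMap.coeFn_toLp μ f)

lemma ContinuousMap.eq_zero_of_ae_eq_zero_unitInterval (f : C(unitInterval, ℝ))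
    (hf : ∀ᵐ t, f t = 0) : f = 0 := by
  have hae : Set.IccExtend zero_le_one f =ᵐ[volume.restrict unitInterval] fun _ => (0 : ℝ) := by
    refine (ae_restrict_iff_subtype measurableSet_Icc).2 ?_
    filter_upwards [hf] with t ht
    simpa using ht
  have h := Measure.eqOn_Icc_of_ae_eq volume zero_ne_one hae
    (f.continuous.Icc_extend' (h := zero_le_one)).continuousOn continuousOn_const
  ext t
  simpa using h t.2

lemma ContinuousMap.eq_zero_of_moments_eq_zero (f : C(unitInterval, ℝ))
    (hf : ∀ r : ℕ, ∫ t : unitInterval, (t : ℝ) ^ r * f t = 0) : f = 0 := by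
  have hint (p : C(unitInterval, ℝ)) : Integrable p :=
    p.continuous.integrable_of_hasCompactSupport (HasCompactSupport.of_compactSpace p)
  have hpoly (p : Polynomial ℝ) : ∫ t : unitInterval, p.eval (t : ℝ) * f t = 0 := by
    simp_rw [Polynomial.eval_eq_sum_range, Finset.sum_mul, mul_assoc]
    rw [integral_finsetSum]
    · simp [integral_const_mul, hf]
    · intro r _
      exact hint (⟨fun t : unitInterval => p.coeff r * ((t : ℝ) ^ r * f t), by fun_prop⟩)
  have hclosed : IsClosed {g : C(unitInterval, ℝ) | ∫ t, (g * f) t = 0} :=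
    isClosed_eq ((ContinuousMap.continuous_integral_of_isFiniteMeasure volume).comp
      (continuous_mul_const f)) continuous_const
  have hsq : ∫ t, (f * f) t = 0 := by
    refine closure_minimal (s := (polynomialFunctions unitInterval : Set C(unitInterval, ℝ)))
      ?_ hclosed (continuousMap_mem_polynomialFunctions_closure 0 1 f)
    rintro _ ⟨p, -, rfl⟩
    exact hpoly p
  refine eq_zero_of_ae_eq_zero_unitInterval f ?_
  filter_upwards [(integral_eq_zero_iff_of_nonneg
    (fun t => mul_self_nonneg (f t)) (hint (f * f))).1 hsq] with t ht
  exact mul_self_eq_zero.1 ht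

/-- Uniqueness part of Theorem 3.2: the law of a random element of
`Fin d → C([0,1], ℝ)` is uniquely determined by the law of the sequence of vectors of
moment integrals `(∫₀¹ tʳ g(i)(t) dt)_{r ∈ ℕ, i ∈ Fin d}`. -/
theorem law_determined_by_moment_integrals
    {d : ℕ} (hd : 1 ≤ d)
    [MeasurableSpace C(Set.Icc (0:ℝ) 1, ℝ)] [BorelSpace C(Set.Icc (0:ℝ) 1, ℝ)]
    {Ω Ω' : Type*} [MeasurableSpace Ω] [MeasurableSpace Ω']
    (P : Measure Ω) (P' : Measure Ω')
    [IsProbabilityMeasure P] [IsProbabilityMeasure P']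
    (X : Ω → Fin d → C(Set.Icc (0:ℝ) 1, ℝ)) (hX : Measurable X)
    (Y : Ω' → Fin d → C(Set.Icc (0:ℝ) 1, ℝ)) (hY : Measurable Y)
    (Φ : (Fin d → C(Set.Icc (0:ℝ) 1, ℝ)) → ℕ → Fin d → ℝ)
    (hΦ : ∀ g r i, Φ g r i = ∫ t : Set.Icc (0:ℝ) 1, (t : ℝ) ^ r * g i t)
    (hlaw : Measure.map (Φ ∘ X) P = Measure.map (Φ ∘ Y) P') :
    Measure.map X P = Measure.map Y P' := by
  let q (r : ℕ) : C(Set.Icc (0:ℝ) 1, ℝ) := ⟨fun t => (t : ℝ) ^ r, by fun_prop⟩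
  have hcont : Continuous Φ := by
    refine continuous_pi fun r => continuous_pi fun i => ?_
    simp_rw [hΦ]
    exact (ContinuousMap.continuous_integral_of_isFiniteMeasure
      (volume : Measure unitInterval)).comp
      ((continuous_const_mul (q r)).comp (continuous_apply i))
  have hinj : Function.Injective Φ := by
    intro g h hgh
    funext i
    refine sub_eq_zero.1 (ContinuousMap.eq_zero_of_moments_eq_zero _ fun r => ?_)
    have hint (p : C(Set.Icc (0:ℝ) 1, ℝ)) :
        Integrable (fun t : Set.Icc (0:ℝ) 1 => (t : ℝ) ^ r * p t) :=
      (q r * p).continuous.integrable_of_hasCompactSupport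
        (μ := (volume : Measure unitInterval)) (HasCompactSupport.of_compactSpace _)
    simp_rw [ContinuousMap.sub_apply, mul_sub]
    rw [integral_sub (hint _) (hint _), ← hΦ, ← hΦ, hgh, sub_self]
  have hemb : MeasurableEmbedding Φ := hcont.measurableEmbedding hinj
  rw [← Measure.map_map hemb.measurable hX, ← Measure.map_map hemb.measurable hY] at hlaw
  rw [← hemb.comap_map (Measure.map X P), hlaw, hemb.comap_map]
end

section
/- Limit of upper triangular square roots (claim (3.21)): let m ≥ 1, let c > 0, and let (R_n)_{n∈ℕ} be a sequence of m×m real matrices such that each R_n is upper triangular ((R_n)_{ij} = 0 for i > j) with nonnegative diagonal entries. If R_nᵀ R_n converges entrywise to c·I (the scalar c times the identity matrix) as n → ∞, then R_n converges entrywise to √c·I. -/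
open Filter Matrix

/-- Claim (3.21): if `R n` are upper triangular `m × m` real matrices with nonnegative
diagonal entries and `Rₙᵀ Rₙ → c·I` entrywise with `c > 0`, then `Rₙ → √c·I` entrywise. -/
theorem upper_triangular_sqrt_limit
    {m : ℕ} (hm : 1 ≤ m) (c : ℝ) (hc : 0 < c)
    (R : ℕ → Matrix (Fin m) (Fin m) ℝ)
    (hut : ∀ n, ∀ i j : Fin m, j < i → R n i j = 0)
    (hdiag : ∀ n, ∀ i : Fin m, 0 ≤ R n i i)
    (hconv : ∀ i j : Fin m,
      Tendsto (fun n => ((R n)ᵀ * R n) i j) atTop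
        (nhds ((c • (1 : Matrix (Fin m) (Fin m) ℝ)) i j))) :
    ∀ i j : Fin m,
      Tendsto (fun n => R n i j) atTop
        (nhds ((Real.sqrt c • (1 : Matrix (Fin m) (Fin m) ℝ)) i j)) := by
  intro i
  induction i using WellFoundedLT.induction with
  | ind i ih =>
    have hoff (j k : Fin m) (hk : k ≠ i) :
        Tendsto (fun n => R n k i * R n k j) atTop (nhds 0) := by
      rcases lt_or_gt_of_ne hk with h | h
      · simpa [Matrix.one_apply_ne hk] using (ih k h i).mul (ih k h j)
      · simp [hut _ k i h]
    have hmul (j : Fin m) : Tendsto (fun n => R n i i * R n i j) atTop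
        (nhds ((c • (1 : Matrix (Fin m) (Fin m) ℝ)) i j)) := by
      have hsum : Tendsto (fun n => ∑ k ∈ Finset.univ.erase i, R n k i * R n k j) atTop
          (nhds 0) := by
        simpa using tendsto_finsetSum (Finset.univ.erase i)
          fun k hk => hoff j k (Finset.ne_of_mem_erase hk)
      have hsub := (hconv i j).sub hsum
      rw [sub_zero] at hsub
      refine hsub.congr fun n => ?_
      rw [Matrix.mul_apply, ← Finset.add_sum_erase _ _ (Finset.mem_univ i)]
      simp [Matrix.transpose_apply]
    have hii : Tendsto (fun n => R n i i) atTop (nhds (Real.sqrt c)) := by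
      have h := (hmul i).sqrt
      simpa [Real.sqrt_mul_self (hdiag _ i)] using h
    have hsqrt : 0 < Real.sqrt c := Real.sqrt_pos.mpr hc
    intro j
    have hquot := (hmul j).div hii hsqrt.ne'
    have hlim : (c • (1 : Matrix (Fin m) (Fin m) ℝ)) i j / Real.sqrt c =
        (Real.sqrt c • (1 : Matrix (Fin m) (Fin m) ℝ)) i j := by
      rw [Matrix.smul_apply, Matrix.smul_apply, smul_eq_mul, smul_eq_mul, mul_div_right_comm,
        Real.div_sqrt]
    rw [hlim] at hquot
    refine hquot.congr' ?_
    filter_upwards [hii.eventually_ne hsqrt.ne'] with n hn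
    exact mul_div_cancel_left₀ _ hn
end

section
/- Convergence of resolvent-equation solutions (deterministic core of Theorem 1.4): let λ_max ≥ 0 and θ > 0. Let μ and μ_n (n ∈ ℕ) be Borel probability measures on ℝ with μ([0, λ_max]) = 1, and suppose there are reals M_n ≥ 0 with μ_n([0, M_n]) = 1 and M_n → λ_max, and that μ_n converges weakly to μ (for every bounded continuous f : ℝ → ℝ, ∫ f dμ_n → ∫ f dμ). Suppose there exists λ > λ_max with ∫ (λ − x)⁻¹ dμ(x) > 1/θ, let λ₁ > λ_max be the unique real with ∫ (λ₁ − x)⁻¹ dμ(x) = 1/θ, and let (t_n) be reals with t_n > M_n and ∫ (t_n − x)⁻¹ dμ_n(x) = 1/θ for each n. Then t_n → λ₁ as n → ∞. -/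
open MeasureTheory Filter

/-- A probability measure giving full mass to `[0, L]` satisfies `x ≤ L` almost everywhere. -/
lemma ae_le_of_measure_Icc_eq_one {ν : Measure ℝ} [IsProbabilityMeasure ν] {L : ℝ}
    (h : ν (Set.Icc 0 L) = 1) : ∀ᵐ x ∂ν, x ≤ L := by
  have h' : ∀ᵐ x ∂ν, x ∈ Set.Icc 0 L := mem_ae_iff_prob_eq_one measurableSet_Icc |>.2 h
  filter_upwards [h'] with x hx using hx.2

lemma resolvent_integrable {ν : Measure ℝ} [IsProbabilityMeasure ν] {L a : ℝ}
    (h : ∀ᵐ x ∂ν, x ≤ L) (ha : L < a) : Integrable (fun x => (a - x)⁻¹) ν := by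
  refine Integrable.of_bound (by fun_prop) (a - L)⁻¹ ?_
  filter_upwards [h] with x hx
  have h1 : 0 < a - L := by linarith
  have h2 : a - L ≤ a - x := by linarith
  rw [Real.norm_of_nonneg (inv_nonneg.2 (h1.le.trans h2))]
  exact inv_anti₀ h1 h2

lemma integral_resolvent_strictAntiOn {ν : Measure ℝ} [IsProbabilityMeasure ν] {L : ℝ}
    (h : ∀ᵐ x ∂ν, x ≤ L) : StrictAntiOn (fun l => ∫ x, (l - x)⁻¹ ∂ν) (Set.Ioi L) := by
  intro a ha b hb hab
  have hlt : ∀ᵐ x ∂ν, (b - x)⁻¹ < (a - x)⁻¹ := by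
    filter_upwards [h] with x hx
    have ha' : L < a := ha
    exact inv_strictAnti₀ (by linarith) (by linarith)
  have hle : (fun x => (b - x)⁻¹) ≤ᵐ[ν] fun x => (a - x)⁻¹ := hlt.mono fun _ => le_of_lt
  have hib := resolvent_integrable h hb
  have hia := resolvent_integrable h ha
  refine (integral_mono_ae hib hia hle).lt_of_ne fun heq => ?_
  obtain ⟨x, hx, hx'⟩ := (hlt.and ((integral_eq_iff_of_ae_le hib hia hle).1 heq)).exists
  exact hx.ne hx'

/-- The resolvent function `x ↦ (l - x)⁻¹` frozen to the right of `c < l`. -/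
noncomputable def clippedResolvent (l c : ℝ) (hc : c < l) : BoundedContinuousFunction ℝ ℝ :=
  BoundedContinuousFunction.ofNormedAddCommGroup (fun x => (l - min x c)⁻¹)
    (Continuous.inv₀ (by fun_prop) fun x => by
      have := min_le_right x c
      linarith)
    (l - c)⁻¹ fun x => by
      have h1 : 0 < l - c := by linarith
      have h2 : l - c ≤ l - min x c := by linarith [min_le_right x c]
      rw [Real.norm_of_nonneg (inv_nonneg.2 (h1.le.trans h2))]
      exact inv_anti₀ h1 h2

lemma integral_clippedResolvent {ν : Measure ℝ} {l c : ℝ} (hc : c < l)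
    (h : ∀ᵐ x ∂ν, x ≤ c) : ∫ x, clippedResolvent l c hc x ∂ν = ∫ x, (l - x)⁻¹ ∂ν := by
  refine integral_congr_ae ?_
  filter_upwards [h] with x hx
  simp [clippedResolvent, min_eq_left hx]

/-- Weak convergence, with supports asymptotically bounded by `L`, implies convergence of the
resolvent integrals at every `l > L`. -/
lemma tendsto_integral_resolvent {μ : Measure ℝ} {μn : ℕ → Measure ℝ} {L l : ℝ} {M : ℕ → ℝ}
    (h : ∀ᵐ x ∂μ, x ≤ L) (hn : ∀ n, ∀ᵐ x ∂(μn n), x ≤ M n)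
    (hM : Tendsto M atTop (nhds L))
    (hweak : ∀ f : BoundedContinuousFunction ℝ ℝ,
      Tendsto (fun n => ∫ x, f x ∂(μn n)) atTop (nhds (∫ x, f x ∂μ)))
    (hl : L < l) :
    Tendsto (fun n => ∫ x, (l - x)⁻¹ ∂(μn n)) atTop (nhds (∫ x, (l - x)⁻¹ ∂μ)) := by
  obtain ⟨c, hLc, hcl⟩ := exists_between hl
  have key := hweak (clippedResolvent l c hcl)
  rw [integral_clippedResolvent hcl (h.mono fun x hx => hx.trans hLc.le)] at key
  refine key.congr' ?_
  filter_upwards [hM.eventually_lt_const hLc] with n hMn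
  exact integral_clippedResolvent hcl ((hn n).mono fun x hx => hx.trans hMn.le)

/-- Deterministic core of Theorem 1.4: if `μ n → μ` weakly, `μ n` is supported in
`[0, M n]` with `M n → λ_max`, `μ` is supported in `[0, λ_max]`, `λ₁ > λ_max` is the
unique solution of `∫ (λ₁ − x)⁻¹ dμ = 1/θ`, and `t n > M n` solves
`∫ (t n − x)⁻¹ dμ n = 1/θ`, then `t n → λ₁`. -/
theorem resolvent_solutions_tendsto
    (lmax : ℝ) (hlmax : 0 ≤ lmax) (θ : ℝ) (hθ : 0 < θ)
    (μ : Measure ℝ) (μn : ℕ → Measure ℝ)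
    [IsProbabilityMeasure μ] [∀ n, IsProbabilityMeasure (μn n)]
    (hsupp : μ (Set.Icc 0 lmax) = 1)
    (M : ℕ → ℝ) (hM0 : ∀ n, 0 ≤ M n) (hMsupp : ∀ n, μn n (Set.Icc 0 (M n)) = 1)
    (hMconv : Tendsto M atTop (nhds lmax))
    (hweak : ∀ f : BoundedContinuousFunction ℝ ℝ,
      Tendsto (fun n => ∫ x, f x ∂(μn n)) atTop (nhds (∫ x, f x ∂μ)))
    (hex : ∃ l : ℝ, lmax < l ∧ 1 / θ < ∫ x, (l - x)⁻¹ ∂μ)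
    (l₁ : ℝ) (hl₁ : lmax < l₁) (hl₁eq : ∫ x, (l₁ - x)⁻¹ ∂μ = 1 / θ)
    (t : ℕ → ℝ) (ht : ∀ n, M n < t n)
    (hteq : ∀ n, ∫ x, (t n - x)⁻¹ ∂(μn n) = 1 / θ) :
    Tendsto t atTop (nhds l₁) := by
  have hμ := ae_le_of_measure_Icc_eq_one hsupp
  have hμn := fun n => ae_le_of_measure_Icc_eq_one (hMsupp n)
  have hlim : ∀ l, lmax < l → _ := fun l hl =>
    tendsto_integral_resolvent hμ hμn hMconv hweak hl
  refine tendsto_order.2 ⟨fun a ha => ?_, fun b hb => ?_⟩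
  · obtain ⟨a', ha', ha'l⟩ := exists_between (max_lt ha hl₁)
    have hla' : lmax < a' := (le_max_right _ _).trans_lt ha'
    have hG : 1 / θ < ∫ x, (a' - x)⁻¹ ∂μ :=
      hl₁eq ▸ integral_resolvent_strictAntiOn hμ hla' hl₁ ha'l
    filter_upwards [(hlim a' hla').eventually_const_lt hG, hMconv.eventually_lt_const hla']
      with n hn hMn
    rw [← hteq n] at hn
    exact (le_max_left _ _).trans_lt
      (ha'.trans (((integral_resolvent_strictAntiOn (hμn n)).lt_iff_gt (ht n) hMn).1 hn))
  · have hlb : lmax < b := hl₁.trans hb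
    have hG : ∫ x, (b - x)⁻¹ ∂μ < 1 / θ :=
      hl₁eq ▸ integral_resolvent_strictAntiOn hμ hl₁ hlb hb
    filter_upwards [(hlim b hlb).eventually_lt_const hG, hMconv.eventually_lt_const hlb]
      with n hn hMn
    rw [← hteq n] at hn
    exact ((integral_resolvent_strictAntiOn (hμn n)).lt_iff_gt hMn (ht n)).1 hn
end
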